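/- Let a, b, c, μ ∈ ℂ with Re a > Re μ > 0 and Re b > Re μ > 0, and assume neither c nor c−μ is a nonpositive integer. Then for every real x < 1, one has ∫_{-∞}^{x} F(a,b;c;y) · (x-y)^{μ-1}/Γ(μ) dy = (Γ(a-μ)/Γ(a)) · (Γ(b-μ)/Γ(b)) · (Γ(c)/Γ(c-μ)) · F(a-μ,b-μ;c-μ;x) (fractional integral transformation of type a−, b−, c−, generalizing a formula of Camporesi). -/

import Mathlib

open MeasureTheory Set Complex Filter

/-- Pochhammer symbol `(a)_k = a (a+1) ⋯ (a+k-1)`. -/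
noncomputable def poch (a : ℂ) (k : ℕ) : ℂ := ∏ i ∈ Finset.range k, (a + i)

/-- The Gauss hypergeometric function `F(a,b;c;x)` for real `x < 1`, defined by the
power series on `[0,1)` and by the (agreeing) Pfaff series for `x < 0`. -/
noncomputable def hypF (a b c : ℂ) (x : ℝ) : ℂ :=
  if 0 ≤ x then
    ∑' k : ℕ, poch a k * poch b k / (poch c k * (Nat.factorial k : ℂ)) * (x : ℂ) ^ k
  else
    ((1 - x : ℝ) : ℂ) ^ (-a) *
      ∑' k : ℕ, poch a k * poch (c - b) k / (poch c k * (Nat.factorial k : ℂ)) *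
        (((x / (x - 1) : ℝ)) : ℂ) ^ k

/-! ### Pochhammer basics -/

theorem poch_zero (a : ℂ) : poch a 0 = 1 := by simp [poch]

theorem poch_succ (a : ℂ) (k : ℕ) : poch a (k + 1) = poch a k * (a + k) := by
  simp [poch, Finset.prod_range_succ]

theorem poch_add (a : ℂ) (j m : ℕ) : poch a (j + m) = poch a j * poch (a + j) m := by
  induction m with
  | zero => simp [poch_zero]
  | succ m ih =>
    rw [← add_assoc, poch_succ, ih, poch_succ]; push_cast; ring

theorem poch_succ_left (a : ℂ) (k : ℕ) : poch a (k + 1) = a * poch (a + 1) k := by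
  rw [add_comm k 1, poch_add]; simp [poch]

theorem poch_ne_zero {a : ℂ} (h : ∀ n : ℕ, a ≠ -(n : ℂ)) (k : ℕ) : poch a k ≠ 0 := by
  rw [poch, Finset.prod_ne_zero_iff]
  intro i _ h0
  exact h i (eq_neg_of_add_eq_zero_left h0)

theorem ne_neg_of_re_pos {a : ℂ} (h : 0 < a.re) (n : ℕ) : a ≠ -(n : ℂ) := by
  rintro rfl
  simp at h
  have : (0 : ℝ) ≤ n := Nat.cast_nonneg n
  linarith

theorem ne_neg_add {a : ℂ} (h : ∀ n : ℕ, a ≠ -(n : ℂ)) (j : ℕ) (n : ℕ) : a + j ≠ -(n : ℂ) := by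
  intro h0
  apply h (n + j)
  push_cast
  linear_combination h0

theorem Gamma_add_nat {a : ℂ} (h : ∀ n : ℕ, a ≠ -(n : ℂ)) (k : ℕ) :
    Complex.Gamma (a + k) = poch a k * Complex.Gamma a := by
  induction k with
  | zero => simp [poch_zero]
  | succ k ih =>
    rw [poch_succ, Nat.cast_succ, ← add_assoc, Complex.Gamma_add_one, ih]
    · ring
    · intro h0; exact h k (eq_neg_of_add_eq_zero_left h0)

theorem norm_poch_le (a : ℂ) (k : ℕ) : ‖poch a k‖ ≤ ‖poch (‖a‖ : ℂ) k‖ := by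
  rw [poch, poch, norm_prod, norm_prod]
  apply Finset.prod_le_prod
  · intros; positivity
  · intro i _
    calc ‖a + i‖ ≤ ‖a‖ + ‖(i : ℂ)‖ := norm_add_le _ _
      _ = ‖a‖ + i := by simp
      _ = ‖((‖a‖ + i : ℝ) : ℂ)‖ := by
        rw [Complex.norm_real, Real.norm_of_nonneg (by positivity)]
      _ = _ := by push_cast; rfl

theorem norm_poch_of_nonneg {a : ℝ} (ha : 0 ≤ a) (k : ℕ) : poch (a : ℂ) k = (‖poch (a : ℂ) k‖ : ℂ) := by
  induction k with
  | zero => simp [poch_zero]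
  | succ k ih =>
    rw [poch_succ, norm_mul, Complex.ofReal_mul, ← ih]
    congr 1
    have : (a : ℂ) + k = ((a + k : ℝ) : ℂ) := by push_cast; rfl
    rw [this, Complex.norm_real, Real.norm_of_nonneg (by positivity)]

/-- Chu-Vandermonde. -/
theorem chu_vandermonde (N : ℕ) : ∀ a b : ℂ,
    ∑ ij ∈ Finset.HasAntidiagonal.antidiagonal N, (N.choose ij.1 : ℂ) * (poch a ij.1 * poch b ij.2)
      = poch (a + b) N := by
  induction N with
  | zero => intro a b; simp [poch_zero]
  | succ N ih =>
    intro a b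
    rw [Finset.sum_antidiagonal_choose_succ_mul (fun i j => poch a i * poch b j) N]
    simp only [poch_succ_left b, poch_succ_left a]
    rw [poch_succ_left, add_mul]
    have h1 := ih a (b + 1)
    have h2 := ih (a + 1) b
    rw [add_comm (a * _)]
    congr 1
    · rw [add_assoc, ← h1, Finset.mul_sum]
      exact Finset.sum_congr rfl fun _ _ => by ring
    · rw [show a + b + 1 = a + 1 + b by ring, ← h2, Finset.mul_sum]
      refine Finset.sum_congr rfl fun ij hij => ?_
      rw [Nat.choose_symm_of_eq_add (Finset.HasAntidiagonal.mem_antidiagonal.1 hij).symm]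
      ring

theorem chu_vandermonde' (N : ℕ) (a b : ℂ) :
    ∑ ij ∈ Finset.HasAntidiagonal.antidiagonal N, (poch a ij.1 / (ij.1.factorial : ℂ)) *
      (poch b ij.2 / (ij.2.factorial : ℂ)) = poch (a + b) N / (N.factorial : ℂ) := by
  rw [← chu_vandermonde, Finset.sum_div]
  refine Finset.sum_congr rfl fun ij hij => ?_
  have hN := (Finset.HasAntidiagonal.mem_antidiagonal.1 hij)
  have h1 : ((ij.1.factorial : ℕ) : ℂ) ≠ 0 := by exact_mod_cast Nat.factorial_ne_zero _
  have h2 : ((ij.2.factorial : ℕ) : ℂ) ≠ 0 := by exact_mod_cast Nat.factorial_ne_zero _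
  have h3 : ((N.factorial : ℕ) : ℂ) ≠ 0 := by exact_mod_cast Nat.factorial_ne_zero _
  have h4 : (N.choose ij.1 : ℂ) * ij.1.factorial * ij.2.factorial = N.factorial := by
    have := Nat.add_choose_mul_factorial_mul_factorial ij.1 ij.2
    rw [hN, ← Nat.choose_symm_of_eq_add hN.symm] at this
    exact_mod_cast this
  rw [← h4] at h3 ⊢
  have h5 : (N.choose ij.1 : ℂ) ≠ 0 := by
    intro h; apply h3; rw [h]; ring
  field_simp

/-- Binomial series. -/
theorem choose_neg_eq (a : ℂ) (n : ℕ) :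
    Ring.choose (-a) n * (-1) ^ n = poch a n / (n.factorial : ℂ) := by
  have h : (n.factorial : ℂ) * Ring.choose (-a) n = (descPochhammer ℤ n).smeval (-a) := by
    rw [Ring.descPochhammer_eq_factorial_smul_choose, nsmul_eq_mul]
  have h2 : (descPochhammer ℤ n).smeval (-a) * (-1) ^ n = poch a n := by
    clear h
    induction n with
    | zero => simp [poch_zero]
    | succ n ih =>
      rw [poch_succ, ← ih]
      simp [descPochhammer_succ_right, Polynomial.smeval_mul, Polynomial.smeval_natCast]
      ring
  have h1 : ((n.factorial : ℕ) : ℂ) ≠ 0 := by exact_mod_cast Nat.factorial_ne_zero _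
  rw [eq_div_iff h1, ← h2, ← h]; ring

theorem binom_hasSum (a : ℂ) {y : ℂ} (hy : ‖y‖ < 1) :
    HasSum (fun m : ℕ => poch a m / (m.factorial : ℂ) * y ^ m) ((1 - y) ^ (-a)) := by
  have := (Complex.one_add_cpow_hasFPowerSeriesOnBall_zero (a := -a)).hasSum (y := -y)
    (by simpa [← ENNReal.ofReal_one, Metric.eball_ofReal] using hy)
  simp only [zero_add, binomialSeries_apply, List.ofFn_const, List.prod_replicate] at this
  have h2 : (fun m : ℕ => poch a m / (m.factorial : ℂ) * y ^ m)
      = fun n => Ring.choose (-a) n • (-y) ^ n := by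
    funext m
    rw [← choose_neg_eq, neg_pow y m, smul_eq_mul]; ring
  rw [h2, sub_eq_add_neg]
  exact this

/-! ### Growth of Pochhammer symbols -/

/-- normalised size of the Pochhammer symbol -/
noncomputable def pratio (z : ℂ) (m : ℕ) : ℝ :=
  ‖poch z m‖ / (m.factorial * ((m : ℝ) + 1) ^ (z.re - 1))

theorem pratio_aux_tendsto (z : ℂ) :
    Tendsto (fun m : ℕ => (((m : ℝ) / (m + 2)) ^ z.re * ((m + 2) / (m + 1)))) atTop (nhds 1) := by
  have h1 : Tendsto (fun m : ℕ => (m : ℝ) / (m + 2)) atTop (nhds 1) :=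
    tendsto_natCast_div_add_atTop 2
  have h2 : Tendsto (fun m : ℕ => ((m : ℝ) + 2) / (m + 1)) atTop (nhds 1) := by
    have h3 : Tendsto (fun m : ℕ => (m : ℝ) / (m + 1)) atTop (nhds 1) :=
      tendsto_natCast_div_add_atTop 1
    have h4 := (h3.div h1 one_ne_zero)
    rw [div_one] at h4
    refine h4.congr' ?_
    filter_upwards [eventually_gt_atTop 0] with m hm
    have : (0 : ℝ) < m := by exact_mod_cast hm
    simp only [Pi.div_apply]
    field_simp
  have h5 := (h1.rpow_const (p := z.re) (Or.inl one_ne_zero)).mul h2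
  simpa using h5

theorem pratio_succ (z : ℂ) {m : ℕ} (hm : 0 < m) :
    pratio z (m + 1) = ‖(Complex.GammaSeq z m)⁻¹‖ *
      (((m : ℝ) / (m + 2)) ^ z.re * ((m + 2) / (m + 1))) := by
  have h0 : (0 : ℝ) < m := by exact_mod_cast hm
  have hf : (0 : ℝ) < m.factorial := by exact_mod_cast Nat.factorial_pos m
  rw [pratio, Complex.GammaSeq, ← poch, inv_div, norm_div, norm_mul,
    Complex.norm_natCast_cpow_of_pos hm, Nat.factorial_succ, Real.div_rpow h0.le (by positivity),
    Real.rpow_sub_one (by positivity), Complex.norm_natCast]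
  push_cast
  rw [show (m : ℝ) + 1 + 1 = m + 2 by ring]
  have h1 : (0 : ℝ) < (m : ℝ) ^ z.re := by positivity
  have h2 : (0 : ℝ) < ((m : ℝ) + 2) ^ z.re := by positivity
  field_simp

theorem pratio_tendsto {z : ℂ} (hz : ∀ n : ℕ, z ≠ -(n : ℂ)) :
    Tendsto (pratio z) atTop (nhds ‖(Complex.Gamma z)⁻¹‖) := by
  rw [← tendsto_add_atTop_iff_nat 1]
  have h1 := (((Complex.GammaSeq_tendsto_Gamma z).inv₀ (Complex.Gamma_ne_zero hz)).norm).mul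
    (pratio_aux_tendsto z)
  rw [mul_one] at h1
  refine h1.congr' ?_
  filter_upwards [eventually_gt_atTop 0] with m hm
  rw [pratio_succ z hm]

theorem poch_eq_zero_of {z : ℂ} {n : ℕ} (hz : z = -(n : ℂ)) {m : ℕ} (hm : n < m) :
    poch z m = 0 := by
  rw [poch, Finset.prod_eq_zero_iff]
  exact ⟨n, Finset.mem_range.2 hm, by rw [hz]; ring⟩

theorem poch_upper (z : ℂ) : ∃ K : ℝ, 0 < K ∧
    ∀ m : ℕ, ‖poch z m‖ ≤ K * (m.factorial * ((m : ℝ) + 1) ^ (z.re - 1)) := by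
  have hb : BddAbove (range (pratio z)) := by
    by_cases hz : ∀ n : ℕ, z ≠ -(n : ℂ)
    · exact (pratio_tendsto hz).bddAbove_range
    · push Not at hz
      obtain ⟨n, hn⟩ := hz
      have : Tendsto (pratio z) atTop (nhds 0) := by
        refine tendsto_const_nhds.congr' ?_
        filter_upwards [eventually_gt_atTop n] with m hm
        rw [pratio, poch_eq_zero_of hn hm]; simp
      exact this.bddAbove_range
  obtain ⟨K, hK⟩ := hb
  refine ⟨max K 1, by positivity, fun m => ?_⟩
  have h := hK (mem_range_self m)
  rw [pratio, div_le_iff₀ (by positivity)] at h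
  refine h.trans ?_
  gcongr
  exact le_max_left _ _

theorem poch_lower {z : ℂ} (hz : ∀ n : ℕ, z ≠ -(n : ℂ)) : ∃ K : ℝ, 0 < K ∧
    ∀ m : ℕ, (m.factorial * ((m : ℝ) + 1) ^ (z.re - 1)) ≤ K * ‖poch z m‖ := by
  have h1 := (pratio_tendsto hz).inv₀ (by simpa using Complex.Gamma_ne_zero hz)
  obtain ⟨K, hK⟩ := h1.bddAbove_range
  refine ⟨max K 1, by positivity, fun m => ?_⟩
  have h := hK (mem_range_self m)
  have hp : 0 < ‖poch z m‖ := norm_pos_iff.2 (poch_ne_zero hz m)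
  simp only [pratio, inv_div] at h
  rw [div_le_iff₀ hp] at h
  refine h.trans ?_
  gcongr
  exact le_max_left _ _

/-- ratio bound -/
theorem poch_div_upper (w : ℂ) {z : ℂ} (hz : ∀ n : ℕ, z ≠ -(n : ℂ)) : ∃ K : ℝ, 0 < K ∧
    ∀ m : ℕ, ‖poch w m / poch z m‖ ≤ K * ((m : ℝ) + 1) ^ (w.re - z.re) := by
  obtain ⟨K, hK, h1⟩ := poch_upper w
  obtain ⟨L, hL, h2⟩ := poch_lower hz
  refine ⟨K * L, by positivity, fun m => ?_⟩
  have hp : 0 < ‖poch z m‖ := norm_pos_iff.2 (poch_ne_zero hz m)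
  rw [norm_div, div_le_iff₀ hp]
  have hm : (0 : ℝ) < (m : ℝ) + 1 := by positivity
  calc ‖poch w m‖ ≤ K * (m.factorial * ((m : ℝ) + 1) ^ (w.re - 1)) := h1 m
    _ = K * ((m : ℝ) + 1) ^ (w.re - z.re) * (m.factorial * ((m : ℝ) + 1) ^ (z.re - 1)) := by
      rw [show w.re - 1 = (w.re - z.re) + (z.re - 1) by ring, Real.rpow_add hm]; ring
    _ ≤ K * ((m : ℝ) + 1) ^ (w.re - z.re) * (L * ‖poch z m‖) := by
      exact mul_le_mul_of_nonneg_left (h2 m) (by positivity)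
    _ = _ := by ring

theorem poch_div_fact_upper (w : ℂ) : ∃ K : ℝ, 0 < K ∧
    ∀ m : ℕ, ‖poch w m / (m.factorial : ℂ)‖ ≤ K * ((m : ℝ) + 1) ^ (w.re - 1) := by
  obtain ⟨K, hK, h1⟩ := poch_upper w
  refine ⟨K, hK, fun m => ?_⟩
  have hf : (0 : ℝ) < m.factorial := by exact_mod_cast Nat.factorial_pos m
  rw [norm_div, Complex.norm_natCast, div_le_iff₀ hf]
  refine (h1 m).trans (le_of_eq ?_)
  ring

theorem summable_neg_rpow {δ : ℝ} (hδ : 0 < δ) :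
    Summable (fun m : ℕ => ((m : ℝ) + 1) ^ (-1 - δ)) := by
  have := (Real.summable_nat_rpow (p := -1 - δ)).2 (by linarith)
  have := (summable_nat_add_iff 1).2 this
  simpa using this

theorem summable_rpow_geom (q : ℝ) {r : ℝ} (hr0 : 0 ≤ r) (hr : r < 1) :
    Summable (fun m : ℕ => ((m : ℝ) + 1) ^ q * r ^ m) := by
  rcases hr0.eq_or_lt with rfl | hr0
  · refine summable_of_ne_finset_zero (s := {0}) fun m hm => ?_
    simp at hm
    simp [hm]
  obtain ⟨k, hk⟩ := exists_nat_ge q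
  have h1 : Summable (fun n : ℕ => (n : ℝ) ^ k * r ^ n) :=
    summable_pow_mul_geometric_of_norm_lt_one k (by rwa [Real.norm_of_nonneg hr0.le])
  have h2 := ((summable_nat_add_iff 1).2 h1).mul_left r⁻¹
  refine Summable.of_nonneg_of_le (fun m => by positivity) (fun m => ?_) h2
  have h3 : r⁻¹ * (((m + 1 : ℕ) : ℝ) ^ k * r ^ (m + 1)) = ((m : ℝ) + 1) ^ k * r ^ m := by
    push_cast
    rw [pow_succ]
    field_simp
  rw [h3]
  gcongr
  rw [← Real.rpow_natCast]
  exact Real.rpow_le_rpow_of_exponent_le (by linarith [(Nat.cast_nonneg m : (0:ℝ) ≤ m)]) hk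

theorem rpow_split_le (q : ℝ) (j m : ℕ) :
    ((j + m : ℕ) + 1 : ℝ) ^ q ≤ ((m : ℝ) + 1) ^ q * ((j : ℝ) + 1) ^ |q| := by
  have hj : (0 : ℝ) ≤ j := Nat.cast_nonneg j
  have hm : (0 : ℝ) ≤ m := Nat.cast_nonneg m
  push_cast
  rcases le_total 0 q with h | h
  · rw [abs_of_nonneg h, ← Real.mul_rpow (by positivity) (by positivity)]
    apply Real.rpow_le_rpow (by positivity) _ h
    nlinarith
  · calc ((j : ℝ) + m + 1) ^ q ≤ ((m : ℝ) + 1) ^ q :=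
        Real.rpow_le_rpow_of_nonpos (by positivity) (by linarith) h
      _ ≤ _ := by
        apply le_mul_of_one_le_right (by positivity)
        exact Real.one_le_rpow (by linarith) (abs_nonneg q)

/-! ### Gauss summation -/

noncomputable def gterm (A B C : ℂ) (m : ℕ) : ℂ :=
  poch A m * poch B m / (poch C m * (m.factorial : ℂ))

theorem gterm_bound (A B : ℂ) {C : ℂ} (hC : ∀ n : ℕ, C ≠ -(n : ℂ)) : ∃ K : ℝ, 0 < K ∧
    ∀ m : ℕ, ‖gterm A B C m‖ ≤ K * ((m : ℝ) + 1) ^ (-1 - (C - A - B).re) := by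
  obtain ⟨K, hK, h1⟩ := poch_div_upper A hC
  obtain ⟨L, hL, h2⟩ := poch_div_fact_upper B
  refine ⟨K * L, by positivity, fun m => ?_⟩
  have hm : (0 : ℝ) < (m : ℝ) + 1 := by positivity
  have : gterm A B C m = (poch A m / poch C m) * (poch B m / (m.factorial : ℂ)) := by
    rw [gterm, div_mul_div_comm]
  rw [this, norm_mul]
  calc _ ≤ (K * ((m : ℝ) + 1) ^ (A.re - C.re)) * (L * ((m : ℝ) + 1) ^ (B.re - 1)) :=
        mul_le_mul (h1 m) (h2 m) (norm_nonneg _) (by positivity)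
    _ = _ := by
      rw [show -1 - (C - A - B).re = (A.re - C.re) + (B.re - 1) by simp; ring, Real.rpow_add hm]
      ring

theorem gterm_summable {A B C : ℂ} (hC : ∀ n : ℕ, C ≠ -(n : ℂ)) (h : 0 < (C - A - B).re) :
    Summable (gterm A B C) := by
  obtain ⟨K, hK, h1⟩ := gterm_bound A B hC
  exact Summable.of_norm_bounded ((summable_neg_rpow h).mul_left K) h1

theorem gterm_rec {A B C : ℂ} (hC : ∀ n : ℕ, C ≠ -(n : ℂ)) (m : ℕ) :
    C * (C - A - B) * gterm A B C m - (C - A) * (C - B) * gterm A B (C + 1) m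
      = -C * ((m + 1 : ℕ) : ℂ) * gterm A B C (m + 1) - (-C * (m : ℂ) * gterm A B C m) := by
  have hC0 : C ≠ 0 := by simpa using hC 0
  have hCm : C + m ≠ 0 := fun h => hC m (eq_neg_of_add_eq_zero_left h)
  have h1 : poch (C + 1) m = poch C m * (C + m) / C := by
    rw [eq_div_iff hC0, ← poch_succ, poch_succ_left]; ring
  have h2 : ((m.factorial : ℕ) : ℂ) ≠ 0 := by exact_mod_cast Nat.factorial_ne_zero _
  have h3 : ((m : ℂ) + 1) ≠ 0 := by exact_mod_cast Nat.succ_ne_zero m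
  have h4 := poch_ne_zero hC m
  simp only [gterm, h1, poch_succ, Nat.factorial_succ]
  push_cast
  field_simp
  ring

theorem gterm_step {A B C : ℂ} (hC : ∀ n : ℕ, C ≠ -(n : ℂ)) (h : 0 < (C - A - B).re) :
    C * (C - A - B) * ∑' m, gterm A B C m = (C - A) * (C - B) * ∑' m, gterm A B (C + 1) m := by
  have hC' : ∀ n : ℕ, C + 1 ≠ -(n : ℂ) := by simpa using ne_neg_add hC 1
  have s1 := (gterm_summable hC h).hasSum.mul_left (C * (C - A - B))
  have s2 := (gterm_summable hC' (A := A) (B := B) (by simp at h ⊢; linarith)).hasSum.mul_left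
    ((C - A) * (C - B))
  have s3 := (s1.sub s2).tendsto_sum_nat
  have s4 : ∀ n : ℕ, ∑ m ∈ Finset.range n, (C * (C - A - B) * gterm A B C m -
      (C - A) * (C - B) * gterm A B (C + 1) m) = -C * (n : ℂ) * gterm A B C n := by
    intro n
    simp_rw [gterm_rec hC]
    rw [Finset.sum_range_sub (fun m : ℕ => -C * (m : ℂ) * gterm A B C m)]
    simp
  simp_rw [s4] at s3
  have s5 : Tendsto (fun n : ℕ => -C * (n : ℂ) * gterm A B C n) atTop (nhds 0) := by
    obtain ⟨K, hK, h1⟩ := gterm_bound A B hC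
    have h6 : Tendsto (fun n : ℕ => ‖C‖ * K * ((n : ℝ) + 1) ^ (-(C - A - B).re)) atTop (nhds 0) := by
      have := ((tendsto_rpow_neg_atTop h).comp
        (tendsto_natCast_atTop_atTop (R := ℝ) |>.atTop_add tendsto_const_nhds (C := (1 : ℝ))))
      simpa using this.const_mul (‖C‖ * K)
    refine squeeze_zero_norm (fun n => ?_) h6
    rw [norm_mul, norm_mul, norm_neg, Complex.norm_natCast]
    have hn : (0 : ℝ) < (n : ℝ) + 1 := by positivity
    calc ‖C‖ * n * ‖gterm A B C n‖
        ≤ ‖C‖ * (n + 1) * (K * ((n : ℝ) + 1) ^ (-1 - (C - A - B).re)) := by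
          gcongr
          · linarith
          · exact h1 n
      _ = _ := by
        rw [show -(C - A - B).re = 1 + (-1 - (C - A - B).re) by ring, Real.rpow_add hn,
          Real.rpow_one]
        ring
  exact sub_eq_zero.1 (tendsto_nhds_unique s3 s5)

theorem gterm_limit (A B C : ℂ) :
    Tendsto (fun n : ℕ => ∑' m, gterm A B (C + n) m) atTop (nhds 1) := by
  obtain ⟨n0, hn0⟩ := exists_nat_gt (max (-C.re) (A.re + B.re - C.re))
  set R : ℝ := C.re + n0 with hR
  have hRpos : 0 < R := by linarith [(le_max_left _ _).trans_lt hn0]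
  have hRAB : A.re + B.re < R := by linarith [(le_max_right _ _).trans_lt hn0]
  have hRn : ∀ n : ℕ, (R : ℂ) ≠ -(n : ℂ) := ne_neg_of_re_pos (by simpa using hRpos)
  have hsum := (gterm_summable (A := A) (B := B) hRn (by simp; linarith)).norm
  have hlim : ∀ m : ℕ, Tendsto (fun n : ℕ => gterm A B (C + n) m) atTop
      (nhds (poch A m * poch B m / (m.factorial : ℂ) * 0 ^ m)) := by
    intro m
    have h1 : ∀ i : ℕ, Tendsto (fun n : ℕ => (C + n + i)⁻¹) atTop (nhds 0) := by
      intro i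
      refine tendsto_inv₀_cobounded.comp (tendsto_norm_atTop_iff_cobounded.1 ?_)
      refine tendsto_atTop_mono (fun n => Complex.re_le_norm _) ?_
      simp only [Complex.add_re, Complex.natCast_re]
      exact ((tendsto_const_nhds (x := C.re)).add_atTop
        (tendsto_natCast_atTop_atTop (R := ℝ))).atTop_add tendsto_const_nhds
    have h2 : Tendsto (fun n : ℕ => ∏ i ∈ Finset.range m, (C + n + i)⁻¹) atTop
        (nhds (∏ i ∈ Finset.range m, (0 : ℂ))) := tendsto_finsetProd _ fun i _ => h1 i
    simp only [Finset.prod_const, Finset.card_range] at h2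
    refine (h2.const_mul _).congr fun n => ?_
    rw [gterm, Finset.prod_inv_distrib, ← poch, div_mul_eq_div_div_swap, div_eq_mul_inv (_ / _)]
  have key := tendsto_tsum_of_dominated_convergence hsum hlim (by
    filter_upwards [eventually_ge_atTop n0] with n hn m
    rw [gterm, gterm, norm_div, norm_div, norm_mul (poch (C + n) m), norm_mul (poch R m)]
    have hp : 0 < ‖poch R m‖ := norm_pos_iff.2 (poch_ne_zero hRn m)
    have hf : (0 : ℝ) < ‖(m.factorial : ℂ)‖ := by
      rw [Complex.norm_natCast]; exact_mod_cast Nat.factorial_pos m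
    gcongr
    rw [poch, poch, norm_prod, norm_prod]
    apply Finset.prod_le_prod
    · intros; positivity
    · intro i _
      have : (R : ℂ) + i = ((R + i : ℝ) : ℂ) := by push_cast; rfl
      rw [this, Complex.norm_real, Real.norm_of_nonneg (by positivity)]
      refine le_trans ?_ (Complex.re_le_norm _)
      simp
      rw [hR]
      have : (n0 : ℝ) ≤ n := by exact_mod_cast hn
      linarith)
  convert key using 2
  rw [tsum_eq_single 0]
  · simp [poch_zero]
  · intro m hm; simp [hm]

theorem gauss_iter {A B C : ℂ} (hC : ∀ n : ℕ, C ≠ -(n : ℂ)) (h : 0 < (C - A - B).re) (n : ℕ) :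
    ∑' m, gterm A B C m = (poch (C - A) n * poch (C - B) n) / (poch C n * poch (C - A - B) n) *
      ∑' m, gterm A B (C + n) m := by
  induction n with
  | zero => simp [poch_zero]
  | succ n ih =>
    have hCn := ne_neg_add hC n
    have hd := ne_neg_of_re_pos h
    have h1 := gterm_step (A := A) (B := B) hCn (by
      simp at h ⊢; linarith [(Nat.cast_nonneg n : (0 : ℝ) ≤ n)])
    have hCn0 : C + n ≠ 0 := by simpa using hCn 0
    have hdn0 : C - A - B + n ≠ 0 := by simpa using ne_neg_add hd n 0
    have hd2 : C + n - A - B ≠ 0 := by convert hdn0 using 1; ring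
    have h2 : ∑' m, gterm A B (C + n) m = (C + n - A) * (C + n - B) /
        ((C + n) * (C + n - A - B)) * ∑' m, gterm A B (C + n + 1) m := by
      rw [div_mul_eq_mul_div, eq_div_iff (mul_ne_zero hCn0 hd2), ← h1]; ring
    rw [ih, h2, poch_succ, poch_succ, poch_succ, poch_succ]
    have e1 := poch_ne_zero hC n
    have e2 := poch_ne_zero hd n
    rw [show C + n - A - B = C - A - B + n by ring, show C + n - A = C - A + n by ring,
      show C + n - B = C - B + n by ring,
      show C + ((n + 1 : ℕ) : ℂ) = C + n + 1 by push_cast; ring]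
    field_simp

theorem gauss {A B C : ℂ} (hC : ∀ n : ℕ, C ≠ -(n : ℂ)) (h : 0 < (C - A - B).re)
    (hCA : ∀ n : ℕ, C - A ≠ -(n : ℂ)) (hCB : ∀ n : ℕ, C - B ≠ -(n : ℂ)) :
    ∑' m, gterm A B C m = Complex.Gamma C * Complex.Gamma (C - A - B) /
      (Complex.Gamma (C - A) * Complex.Gamma (C - B)) := by
  have hd := ne_neg_of_re_pos h
  have t1 := ((Complex.GammaSeq_tendsto_Gamma C).mul
    (Complex.GammaSeq_tendsto_Gamma (C - A - B))).div
    ((Complex.GammaSeq_tendsto_Gamma (C - A)).mul (Complex.GammaSeq_tendsto_Gamma (C - B)))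
    (mul_ne_zero (Complex.Gamma_ne_zero hCA) (Complex.Gamma_ne_zero hCB))
  have t2 := (tendsto_add_atTop_iff_nat 1).2 (gterm_limit A B C)
  have t3 := t1.mul t2
  rw [mul_one] at t3
  refine tendsto_nhds_unique (tendsto_const_nhds.congr' ?_) t3
  filter_upwards [eventually_gt_atTop 0] with n hn
  rw [gauss_iter hC h (n + 1)]
  congr 1
  have hn0 : (n : ℂ) ≠ 0 := by exact_mod_cast hn.ne'
  have hf : ((n.factorial : ℕ) : ℂ) ≠ 0 := by exact_mod_cast Nat.factorial_ne_zero _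
  have hpow : (n : ℂ) ^ C * (n : ℂ) ^ (C - A - B) = (n : ℂ) ^ (C - A) * (n : ℂ) ^ (C - B) := by
    rw [← Complex.cpow_add _ _ hn0, ← Complex.cpow_add _ _ hn0]; congr 1; ring
  have q1 : (n : ℂ) ^ (C - A) ≠ 0 := by simp [Complex.cpow_eq_zero_iff, hn0]
  have q2 : (n : ℂ) ^ (C - B) ≠ 0 := by simp [Complex.cpow_eq_zero_iff, hn0]
  simp only [Pi.div_apply, Complex.GammaSeq]
  rw [← poch, ← poch, ← poch, ← poch]
  have e1 := poch_ne_zero hC (n + 1)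
  have e2 := poch_ne_zero hd (n + 1)
  have e3 := poch_ne_zero hCA (n + 1)
  have e4 := poch_ne_zero hCB (n + 1)
  have : (n : ℂ) ^ C * n.factorial / poch C (n + 1) *
      ((n : ℂ) ^ (C - A - B) * n.factorial / poch (C - A - B) (n + 1)) =
      ((n : ℂ) ^ (C - A) * (n : ℂ) ^ (C - B)) * n.factorial * n.factorial /
        (poch C (n + 1) * poch (C - A - B) (n + 1)) := by
    rw [← hpow]; field_simp
  rw [this]
  field_simp

/-! ### Double series -/

theorem tsum_antidiag {f : ℕ × ℕ → ℂ} (hf : Summable f) :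
    ∑' p, f p = ∑' N, ∑ p ∈ Finset.HasAntidiagonal.antidiagonal N, f p := by
  conv_rhs => congr; ext; rw [← Finset.sum_finset_coe, ← tsum_fintype (L := .unconditional _)]
  rw [← Finset.HasAntidiagonal.sigmaAntidiagonalEquivProd.tsum_eq f]
  exact (Finset.HasAntidiagonal.sigmaAntidiagonalEquivProd.summable_iff.2 hf).tsum_sigma'
    (fun n ↦ (hasSum_fintype _).summable)

theorem summable_antidiag {f : ℕ × ℕ → ℝ} (hf0 : ∀ p, 0 ≤ f p)
    (hf : Summable fun N => ∑ p ∈ Finset.HasAntidiagonal.antidiagonal N, f p) : Summable f := by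
  rw [← Finset.HasAntidiagonal.sigmaAntidiagonalEquivProd.summable_iff]
  refine (summable_sigma_of_nonneg (fun _ => hf0 _)).2 ?_
  refine ⟨fun n => (hasSum_fintype _).summable, ?_⟩
  convert hf using 2 with N
  rw [tsum_fintype]
  exact Finset.sum_coe_sort (Finset.HasAntidiagonal.antidiagonal N) f

theorem add_pow_fact {R : Type*} [Field R] [CharZero R] (x y : R) (n : ℕ) :
    (x + y) ^ n / (n.factorial : R) = ∑ p ∈ Finset.HasAntidiagonal.antidiagonal n,
      (x ^ p.1 / (p.1.factorial : R)) * (y ^ p.2 / (p.2.factorial : R)) := by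
  rw [(Commute.all x y).add_pow' n, Finset.sum_div]
  refine Finset.sum_congr rfl fun ij hij => ?_
  have hN := (Finset.HasAntidiagonal.mem_antidiagonal.1 hij)
  have h1 : ((ij.1.factorial : ℕ) : R) ≠ 0 := by exact_mod_cast Nat.factorial_ne_zero _
  have h2 : ((ij.2.factorial : ℕ) : R) ≠ 0 := by exact_mod_cast Nat.factorial_ne_zero _
  have h3 : ((n.factorial : ℕ) : R) ≠ 0 := by exact_mod_cast Nat.factorial_ne_zero _
  have h4 : (n.choose ij.1 : R) * ij.1.factorial * ij.2.factorial = n.factorial := by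
    have := Nat.add_choose_mul_factorial_mul_factorial ij.1 ij.2
    rw [hN, ← Nat.choose_symm_of_eq_add hN.symm] at this
    exact_mod_cast this
  rw [← h4] at h3 ⊢
  have h5 : (n.choose ij.1 : R) ≠ 0 := by
    intro h; apply h3; rw [h]; ring
  rw [nsmul_eq_mul]
  field_simp

theorem gterm_geom_summable (A B : ℂ) {C : ℂ} (hC : ∀ n : ℕ, C ≠ -(n : ℂ)) {r : ℝ} (h0 : 0 ≤ r)
    (h1 : r < 1) : Summable fun n => ‖gterm A B C n‖ * r ^ n := by
  obtain ⟨K, hK, hb⟩ := gterm_bound A B hC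
  refine Summable.of_nonneg_of_le (fun n => by positivity) (fun n => ?_)
    ((summable_rpow_geom (-1 - (C - A - B).re) h0 h1).mul_left K)
  rw [← mul_assoc]
  exact mul_le_mul_of_nonneg_right (hb n) (by positivity)

/-- expansion used for `x < 0` -/
theorem binom_expand (e : ℕ → ℂ) {p q : ℝ} (hp : 0 ≤ p) (hq : 0 ≤ q)
    (hs : Summable fun k => ‖e k‖ / (k.factorial : ℝ) * (p + q) ^ k) :
    ∑' k, e k / (k.factorial : ℂ) * ((p + q : ℝ) : ℂ) ^ k =
      ∑' jm : ℕ × ℕ, e (jm.1 + jm.2) / ((jm.1.factorial : ℂ) * (jm.2.factorial : ℂ)) *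
        (p : ℂ) ^ jm.1 * (q : ℂ) ^ jm.2 := by
  rw [tsum_antidiag]
  · refine tsum_congr fun k => ?_
    push_cast
    rw [div_mul_eq_mul_div, mul_div_assoc, add_pow_fact, Finset.mul_sum]
    refine Finset.sum_congr rfl fun ij hij => ?_
    rw [Finset.HasAntidiagonal.mem_antidiagonal.1 hij]
    field_simp
  · apply Summable.of_norm
    apply summable_antidiag (fun _ => norm_nonneg _)
    convert hs using 2 with k
    rw [div_mul_eq_mul_div, mul_div_assoc, add_pow_fact, Finset.mul_sum]
    refine Finset.sum_congr rfl fun ij hij => ?_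
    rw [Finset.HasAntidiagonal.mem_antidiagonal.1 hij]
    simp only [norm_mul, norm_div, norm_pow, Complex.norm_natCast, Complex.norm_real,
      Real.norm_of_nonneg hp, Real.norm_of_nonneg hq]
    field_simp

theorem binom_hasSum_real {α : ℝ} (hα : 0 ≤ α) {Y : ℝ} (h0 : 0 ≤ Y) (h1 : Y < 1) :
    HasSum (fun m : ℕ => ‖poch (α : ℂ) m‖ / (m.factorial : ℝ) * Y ^ m) ((1 - Y) ^ (-α)) := by
  have := binom_hasSum (α : ℂ) (y := (Y : ℂ)) (by
    rwa [Complex.norm_real, Real.norm_of_nonneg h0])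
  rw [← Complex.hasSum_ofReal]
  convert this using 2 with m
  · push_cast
    rw [← norm_poch_of_nonneg hα]
  · rw [Complex.ofReal_cpow (by linarith)]; push_cast; rfl

theorem antidiag_triple (F : ℕ → ℕ → ℕ → ℂ) (N : ℕ) :
    ∑ p ∈ Finset.HasAntidiagonal.antidiagonal N,
      ∑ q ∈ Finset.HasAntidiagonal.antidiagonal p.1, F q.1 q.2 p.2
    = ∑ p ∈ Finset.HasAntidiagonal.antidiagonal N,
      ∑ q ∈ Finset.HasAntidiagonal.antidiagonal p.2, F p.1 q.1 q.2 := by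
  rw [Finset.sum_sigma', Finset.sum_sigma']
  refine Finset.sum_nbij' (fun x => ⟨(x.2.1, x.2.2 + x.1.2), (x.2.2, x.1.2)⟩)
    (fun x => ⟨(x.1.1 + x.2.1, x.2.2), (x.1.1, x.2.1)⟩) ?_ ?_ ?_ ?_ ?_
  · rintro ⟨⟨n, k⟩, ⟨i, l⟩⟩ h; simp at h ⊢; omega
  · rintro ⟨⟨n, k⟩, ⟨i, l⟩⟩ h; simp at h ⊢; omega
  · rintro ⟨⟨n, k⟩, ⟨i, l⟩⟩ h; simp at h ⊢; omega
  · rintro ⟨⟨n, k⟩, ⟨i, l⟩⟩ h; simp at h ⊢; omega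
  · rintro ⟨⟨n, k⟩, ⟨i, l⟩⟩ h; rfl

theorem h_identity {b b' c : ℂ} (hbc : b + b' = c) (hc : ∀ n : ℕ, c ≠ -(n : ℂ)) (D Y : ℂ) (N : ℕ) :
    ∑ p ∈ Finset.HasAntidiagonal.antidiagonal N, poch b p.1 / (p.1.factorial : ℂ) *
      (poch b' p.2 / (p.2.factorial : ℂ)) * (D + Y) ^ p.1 * Y ^ p.2
    = poch c N * ∑ p ∈ Finset.HasAntidiagonal.antidiagonal N,
      poch b p.1 / (poch c p.1 * (p.1.factorial : ℂ) * (p.2.factorial : ℂ)) * D ^ p.1 * Y ^ p.2 := by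
  have e1 : ∀ p ∈ Finset.HasAntidiagonal.antidiagonal N, poch b p.1 / (p.1.factorial : ℂ) *
      (poch b' p.2 / (p.2.factorial : ℂ)) * (D + Y) ^ p.1 * Y ^ p.2
      = ∑ q ∈ Finset.HasAntidiagonal.antidiagonal p.1, (poch b (q.1 + q.2) * (poch b' p.2 /
        (p.2.factorial : ℂ)) * (D ^ q.1 / (q.1.factorial : ℂ)) * (Y ^ q.2 / (q.2.factorial : ℂ)) *
          Y ^ p.2) := by
    intro p _
    have : poch b p.1 / (p.1.factorial : ℂ) *
      (poch b' p.2 / (p.2.factorial : ℂ)) * (D + Y) ^ p.1 * Y ^ p.2 =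
      poch b p.1 * (poch b' p.2 / (p.2.factorial : ℂ)) * Y ^ p.2 *
        ((D + Y) ^ p.1 / (p.1.factorial : ℂ)) := by ring
    rw [this, add_pow_fact, Finset.mul_sum]
    refine Finset.sum_congr rfl fun q hq => ?_
    rw [Finset.HasAntidiagonal.mem_antidiagonal.1 hq]
    ring
  rw [Finset.sum_congr rfl e1, antidiag_triple (fun i l k => poch b (i + l) * (poch b' k /
        (k.factorial : ℂ)) * (D ^ i / (i.factorial : ℂ)) * (Y ^ l / (l.factorial : ℂ)) *
          Y ^ k), Finset.mul_sum]
  refine Finset.sum_congr rfl fun p hp => ?_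
  have e2 : ∀ q ∈ Finset.HasAntidiagonal.antidiagonal p.2,
      poch b (p.1 + q.1) * (poch b' q.2 / (q.2.factorial : ℂ)) * (D ^ p.1 / (p.1.factorial : ℂ)) *
        (Y ^ q.1 / (q.1.factorial : ℂ)) * Y ^ q.2
      = (poch b p.1 * (D ^ p.1 / (p.1.factorial : ℂ)) * Y ^ p.2) *
        ((poch (b + p.1) q.1 / (q.1.factorial : ℂ)) * (poch b' q.2 / (q.2.factorial : ℂ))) := by
    intro q hq
    rw [← Finset.HasAntidiagonal.mem_antidiagonal.1 hq, poch_add, pow_add]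
    ring
  rw [Finset.sum_congr rfl e2, ← Finset.mul_sum, chu_vandermonde',
    ← Finset.HasAntidiagonal.mem_antidiagonal.1 hp, poch_add, ← hbc,
    show b + p.1 + b' = b + b' + p.1 by ring]
  have h4 := poch_ne_zero hc p.1
  rw [← hbc] at h4
  field_simp

/-- Reduction of the Appell series `F₁`. -/
theorem appell_reduction (a : ℂ) {b b' c : ℂ} (hbc : b + b' = c) (hc : ∀ n : ℕ, c ≠ -(n : ℂ))
    {X Y : ℝ} (hY : 0 ≤ Y) (hYX : Y ≤ X) (hX : X < 1) :
    ∑' p : ℕ × ℕ, poch a (p.1 + p.2) * (poch b p.1 * poch b' p.2 /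
        (poch c (p.1 + p.2) * (p.1.factorial : ℂ) * (p.2.factorial : ℂ))) *
        (X : ℂ) ^ p.1 * (Y : ℂ) ^ p.2
      = ((1 - Y : ℝ) : ℂ) ^ (-a) * ∑' k, gterm a b c k * (((X - Y) / (1 - Y) : ℝ) : ℂ) ^ k := by
  have hY1 : 0 < 1 - Y := by linarith
  have hZ0 : 0 ≤ (X - Y) / (1 - Y) := div_nonneg (by linarith) hY1.le
  have hZ1 : (X - Y) / (1 - Y) < 1 := by rw [div_lt_one hY1]; linarith
  have hX0 : 0 ≤ X := hY.trans hYX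
  -- left side
  have hf : Summable fun p : ℕ × ℕ => poch a (p.1 + p.2) * (poch b p.1 * poch b' p.2 /
        (poch c (p.1 + p.2) * (p.1.factorial : ℂ) * (p.2.factorial : ℂ))) *
        (X : ℂ) ^ p.1 * (Y : ℂ) ^ p.2 := by
    obtain ⟨K, hK, h1⟩ := poch_div_upper a hc
    obtain ⟨L, hL, h2⟩ := poch_div_fact_upper b
    obtain ⟨M, hM, h3⟩ := poch_div_fact_upper b'
    have s1 := summable_rpow_geom (|a.re - c.re| + (b.re - 1)) hX0 hX
    have s2 := summable_rpow_geom ((a.re - c.re) + (b'.re - 1)) hY (by linarith : Y < 1)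
    have s3 := (s1.mul_of_nonneg s2 (fun _ => by positivity) (fun _ => by positivity)).mul_left
      (K * L * M)
    refine Summable.of_norm_bounded s3 fun p => ?_
    have e : poch a (p.1 + p.2) * (poch b p.1 * poch b' p.2 /
        (poch c (p.1 + p.2) * (p.1.factorial : ℂ) * (p.2.factorial : ℂ))) *
        (X : ℂ) ^ p.1 * (Y : ℂ) ^ p.2 = (poch a (p.1 + p.2) / poch c (p.1 + p.2)) *
        (poch b p.1 / (p.1.factorial : ℂ)) * (poch b' p.2 / (p.2.factorial : ℂ)) *
        ((X : ℂ) ^ p.1 * (Y : ℂ) ^ p.2) := by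
      field_simp
    rw [e, norm_mul, norm_mul, norm_mul, norm_mul, norm_pow, norm_pow, Complex.norm_real,
      Complex.norm_real, Real.norm_of_nonneg hX0, Real.norm_of_nonneg hY]
    have hm1 : (0 : ℝ) < (p.1 : ℝ) + 1 := by positivity
    have hm2 : (0 : ℝ) < (p.2 : ℝ) + 1 := by positivity
    calc _ ≤ (K * (((p.2 : ℝ) + 1) ^ (a.re - c.re) * ((p.1 : ℝ) + 1) ^ |a.re - c.re|)) *
          (L * ((p.1 : ℝ) + 1) ^ (b.re - 1)) * (M * ((p.2 : ℝ) + 1) ^ (b'.re - 1)) *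
          (X ^ p.1 * Y ^ p.2) := by
            refine mul_le_mul_of_nonneg_right ?_ (by positivity)
            refine mul_le_mul ?_ (h3 _) (norm_nonneg _) (by positivity)
            refine mul_le_mul ?_ (h2 _) (norm_nonneg _) (by positivity)
            exact (h1 _).trans (mul_le_mul_of_nonneg_left (rpow_split_le _ _ _) hK.le)
      _ = _ := by
        rw [Real.rpow_add hm1, Real.rpow_add hm2]; ring
  -- right side
  set g : ℕ × ℕ → ℂ := fun p => poch a (p.1 + p.2) * (poch b p.1 /
    (poch c p.1 * (p.1.factorial : ℂ) * (p.2.factorial : ℂ)) * ((X - Y : ℝ) : ℂ) ^ p.1 *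
      (Y : ℂ) ^ p.2) with hg
  have hgS : Summable g := by
    set α : ℝ := ‖a‖
    have hα : 0 ≤ α := norm_nonneg a
    set G : ℕ × ℕ → ℝ := fun p => (‖poch (α : ℂ) p.1‖ * ‖poch b p.1 /
      (poch c p.1 * (p.1.factorial : ℂ))‖ * (X - Y) ^ p.1) *
      (‖poch ((α + p.1 : ℝ) : ℂ) p.2‖ / (p.2.factorial : ℝ) * Y ^ p.2) with hG
    have hG0 : 0 ≤ G := fun p => by
      have : 0 ≤ X - Y := by linarith
      simp only [hG]; positivity
    have hGi : ∀ n : ℕ, HasSum (fun m => G (n, m)) ((‖poch (α : ℂ) n‖ * ‖poch b n /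
      (poch c n * (n.factorial : ℂ))‖ * (X - Y) ^ n) * (1 - Y) ^ (-(α + n))) := fun n =>
      (binom_hasSum_real (by positivity : 0 ≤ α + n) hY (by linarith)).mul_left _
    have hGS : Summable G := by
      refine (summable_prod_of_nonneg hG0).2 ⟨fun n => (hGi n).summable, ?_⟩
      simp_rw [fun n => (hGi n).tsum_eq]
      refine ((gterm_geom_summable (α : ℂ) b hc hZ0 hZ1).mul_left ((1 - Y) ^ (-α))).congr
        fun n => ?_
      symm
      rw [neg_add, Real.rpow_add hY1, Real.rpow_neg hY1.le (n : ℝ), Real.rpow_natCast, div_pow,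
        gterm, mul_div_assoc, norm_mul]
      field_simp
    refine Summable.of_norm_bounded hGS fun p => ?_
    simp only [hg, hG, norm_mul, norm_div, norm_pow, Complex.norm_natCast, Complex.norm_real,
      Real.norm_of_nonneg hY, Real.norm_of_nonneg (by linarith : 0 ≤ X - Y)]
    have h5 := norm_poch_le a (p.1 + p.2)
    rw [poch_add (‖a‖ : ℂ), norm_mul] at h5
    push_cast
    calc _ ≤ (‖poch (α : ℂ) p.1‖ * ‖poch ((α : ℂ) + p.1) p.2‖) * (‖poch b p.1‖ /
        (‖poch c p.1‖ * p.1.factorial * p.2.factorial) * (X - Y) ^ p.1 * Y ^ p.2) := by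
          refine mul_le_mul_of_nonneg_right h5 ?_
          have : 0 ≤ X - Y := by linarith
          positivity
      _ = _ := by field_simp
  have hgT : ∑' p, g p = ((1 - Y : ℝ) : ℂ) ^ (-a) *
      ∑' k, gterm a b c k * (((X - Y) / (1 - Y) : ℝ) : ℂ) ^ k := by
    rw [hgS.tsum_prod, ← tsum_mul_left]
    refine tsum_congr fun n => ?_
    have hb := (binom_hasSum (a + n) (y := (Y : ℂ)) (by
      rw [Complex.norm_real, Real.norm_of_nonneg hY]; linarith)).mul_left
        (gterm a b c n * ((X - Y : ℝ) : ℂ) ^ n)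
    have hY1' : ((1 - Y : ℝ) : ℂ) ≠ 0 := by exact_mod_cast hY1.ne'
    have e : (fun m => g (n, m)) = fun m => gterm a b c n * ((X - Y : ℝ) : ℂ) ^ n *
        (poch (a + n) m / (m.factorial : ℂ) * (Y : ℂ) ^ m) := by
      funext m
      simp only [hg, gterm, poch_add]
      field_simp
    rw [e, hb.tsum_eq, neg_add, show (1 : ℂ) - Y = ((1 - Y : ℝ) : ℂ) by push_cast; rfl,
      Complex.cpow_add _ _ hY1', Complex.cpow_neg _ (n : ℂ), Complex.cpow_natCast,
      Complex.ofReal_div, div_pow]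
    field_simp
  rw [← hgT, tsum_antidiag hf, tsum_antidiag hgS]
  refine tsum_congr fun N => ?_
  have hid := h_identity hbc hc ((X - Y : ℝ) : ℂ) (Y : ℂ) N
  have e1 : ((X - Y : ℝ) : ℂ) + Y = X := by push_cast; ring
  rw [e1] at hid
  have hcN := poch_ne_zero hc N
  have e2 : ∑ p ∈ Finset.HasAntidiagonal.antidiagonal N, g p = poch a N *
      ∑ p ∈ Finset.HasAntidiagonal.antidiagonal N,
      poch b p.1 / (poch c p.1 * (p.1.factorial : ℂ) * (p.2.factorial : ℂ)) *
        ((X - Y : ℝ) : ℂ) ^ p.1 * (Y : ℂ) ^ p.2 := by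
    rw [Finset.mul_sum]
    refine Finset.sum_congr rfl fun p hp => ?_
    simp only [hg]
    rw [Finset.HasAntidiagonal.mem_antidiagonal.1 hp]
  rw [e2, ← mul_right_inj' hcN, mul_left_comm, ← hid, Finset.mul_sum, Finset.mul_sum]
  refine Finset.sum_congr rfl fun p hp => ?_
  rw [Finset.HasAntidiagonal.mem_antidiagonal.1 hp]
  field_simp

/-! ### The beta integrals and the core integration lemma -/

/-- the beta integrand -/
noncomputable def bint (s t : ℂ) (u : ℝ) : ℂ := (u : ℂ) ^ (s - 1) * (1 - (u : ℂ)) ^ (t - 1)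

theorem bint_integrable {s t : ℂ} (hs : 0 < s.re) (ht : 0 < t.re) :
    Integrable (bint s t) (volume.restrict (Ioo 0 1)) := by
  have := Complex.betaIntegral_convergent hs ht
  rw [intervalIntegrable_iff_integrableOn_Ioo_of_le zero_le_one] at this
  exact this

theorem bint_integral {s t : ℂ} (hs : 0 < s.re) (ht : 0 < t.re) :
    ∫ u in Ioo (0 : ℝ) 1, bint s t u = Complex.Gamma s * Complex.Gamma t / Complex.Gamma (s + t) := by
  have h0 : Complex.Gamma (s + t) ≠ 0 :=
    Complex.Gamma_ne_zero (ne_neg_of_re_pos (by simp; linarith))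
  rw [eq_div_iff h0, Complex.Gamma_mul_Gamma_eq_betaIntegral hs ht, Complex.betaIntegral,
    intervalIntegral.integral_of_le zero_le_one, integral_Ioc_eq_integral_Ioo, mul_comm]
  rfl

theorem bint_integral_shift {s t : ℂ} (hs : 0 < s.re) (ht : 0 < t.re) (j m : ℕ) :
    ∫ u in Ioo (0 : ℝ) 1, bint (s + m) (t + j) u =
      poch s m * poch t j / poch (s + t) (j + m) *
      (Complex.Gamma s * Complex.Gamma t / Complex.Gamma (s + t)) := by
  have hj : (0 : ℝ) ≤ j := Nat.cast_nonneg j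
  have hm : (0 : ℝ) ≤ m := Nat.cast_nonneg m
  rw [bint_integral (by simp; linarith) (by simp; linarith),
    Gamma_add_nat (ne_neg_of_re_pos hs), Gamma_add_nat (ne_neg_of_re_pos ht),
    show s + m + (t + j) = s + t + ((j + m : ℕ) : ℂ) by push_cast; ring,
    Gamma_add_nat (ne_neg_of_re_pos (by simp; linarith))]
  field_simp

theorem norm_bint {s t : ℂ} {u : ℝ} (hu : u ∈ Ioo (0 : ℝ) 1) :
    (‖bint s t u‖ : ℂ) = bint (s.re : ℂ) (t.re : ℂ) u := by
  have h1 : 0 < 1 - u := by linarith [hu.2]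
  have e : (1 : ℂ) - u = ((1 - u : ℝ) : ℂ) := by push_cast; rfl
  rw [bint, bint, norm_mul, e, Complex.norm_cpow_eq_rpow_re_of_pos hu.1,
    Complex.norm_cpow_eq_rpow_re_of_pos h1]
  push_cast
  rw [Complex.ofReal_cpow hu.1.le, Complex.ofReal_cpow h1.le]
  simp

theorem norm_bint_integral {s t : ℂ} (hs : 0 < s.re) (ht : 0 < t.re) (j m : ℕ) :
    ∫ u in Ioo (0 : ℝ) 1, ‖bint (s + m) (t + j) u‖ =
      ‖poch (s.re : ℂ) m * poch (t.re : ℂ) j / poch ((s.re + t.re : ℝ) : ℂ) (j + m) *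
      (Complex.Gamma s.re * Complex.Gamma t.re / Complex.Gamma ((s.re + t.re : ℝ) : ℂ))‖ := by
  have h1 := bint_integral_shift (s := (s.re : ℂ)) (t := (t.re : ℂ)) (by simpa) (by simpa) j m
  have h2 : ∫ u in Ioo (0 : ℝ) 1, bint ((s.re : ℂ) + m) ((t.re : ℂ) + j) u =
      ((∫ u in Ioo (0 : ℝ) 1, ‖bint (s + m) (t + j) u‖ : ℝ) : ℂ) := by
    rw [← integral_complex_ofReal]
    refine setIntegral_congr_fun measurableSet_Ioo fun u hu => ?_
    rw [norm_bint hu]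
    simp
  rw [h2] at h1
  push_cast
  rw [← h1, Complex.norm_real, Real.norm_of_nonneg]
  exact integral_nonneg fun _ => norm_nonneg _

theorem core {a μ : ℂ} (ha : μ.re < a.re) (hμ : 0 < μ.re) {v : ℝ} (hv : |v| < 1) (B : ℕ × ℕ → ℂ)
    {K q δ : ℝ} (hδ : 0 < δ) (hB : ∀ p : ℕ × ℕ, ‖B p‖ * ((p.1.factorial : ℝ) * (p.2.factorial : ℝ)) ≤
      K * (((p.1 : ℝ) + 1) ^ q * ((p.2 : ℝ) + 1) ^ (-μ.re - δ))) :
    ∫ u in Ioo (0 : ℝ) 1, ∑' p : ℕ × ℕ, poch a (p.1 + p.2) * B p * (v : ℂ) ^ p.1 *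
        bint (μ + p.2) (a - μ + p.1) u
      = Complex.Gamma μ * Complex.Gamma (a - μ) / Complex.Gamma a *
        ∑' j : ℕ, poch (a - μ) j * (v : ℂ) ^ j * ∑' m : ℕ, poch μ m * B (j, m) := by
  have hd : 0 < (a - μ).re := by simp; linarith
  have hK : 0 ≤ K := by
    have := hB (0, 0)
    simp at this
    exact (norm_nonneg _).trans this
  have hapos : 0 < a.re := by linarith
  have hapole := ne_neg_of_re_pos hapos
  have hintg : ∀ p : ℕ × ℕ, Integrable (fun u => poch a (p.1 + p.2) * B p * (v : ℂ) ^ p.1 *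
        bint (μ + p.2) (a - μ + p.1) u) (volume.restrict (Ioo 0 1)) := by
    intro p
    have hj : (0 : ℝ) ≤ p.1 := Nat.cast_nonneg _
    have hm : (0 : ℝ) ≤ p.2 := Nat.cast_nonneg _
    refine (bint_integrable ?_ ?_).const_mul _
    · simp; linarith
    · simp; linarith
  have hval : ∀ p : ℕ × ℕ, ∫ u in Ioo (0 : ℝ) 1, poch a (p.1 + p.2) * B p * (v : ℂ) ^ p.1 *
        bint (μ + p.2) (a - μ + p.1) u = Complex.Gamma μ * Complex.Gamma (a - μ) / Complex.Gamma a *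
        (poch (a - μ) p.1 * (v : ℂ) ^ p.1 * (poch μ p.2 * B p)) := by
    intro p
    rw [integral_const_mul, bint_integral_shift hμ hd, show μ + (a - μ) = a by ring]
    have := poch_ne_zero hapole (p.1 + p.2)
    field_simp
  have hsum : Summable fun p : ℕ × ℕ => ∫ u in Ioo (0 : ℝ) 1, ‖poch a (p.1 + p.2) * B p *
      (v : ℂ) ^ p.1 * bint (μ + p.2) (a - μ + p.1) u‖ := by
    simp_rw [norm_mul (poch a _ * B _ * _), integral_const_mul, norm_bint_integral hμ hd]
    have e : ((μ.re + (a - μ).re : ℝ) : ℂ) = (a.re : ℂ) := by simp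
    rw [e]
    have hRn : ∀ n : ℕ, (a.re : ℂ) ≠ -(n : ℂ) := ne_neg_of_re_pos (by simpa using hapos)
    obtain ⟨K1, hK1, h1⟩ := poch_div_upper a hRn
    obtain ⟨K2, hK2, h2⟩ := poch_div_fact_upper (μ.re : ℂ)
    obtain ⟨K3, hK3, h3⟩ := poch_div_fact_upper ((a - μ).re : ℂ)
    set g := ‖Complex.Gamma μ.re * Complex.Gamma (a - μ).re / Complex.Gamma a.re‖ with hg
    have hg0 : 0 ≤ g := norm_nonneg _
    have s1 := summable_rpow_geom (q + ((a - μ).re - 1)) (abs_nonneg v) hv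
    have s2 := summable_neg_rpow hδ
    have s3 := (s1.mul_of_nonneg s2 (fun _ => by positivity) (fun _ => by positivity)).mul_left
      (K1 * K * K2 * K3 * g)
    refine Summable.of_nonneg_of_le (fun p => by positivity) (fun p => ?_) s3
    have hm1 : (0 : ℝ) < (p.1 : ℝ) + 1 := by positivity
    have hm2 : (0 : ℝ) < (p.2 : ℝ) + 1 := by positivity
    have h1p := h1 (p.1 + p.2)
    simp only [Complex.ofReal_re, sub_self, Real.rpow_zero, mul_one] at h1p
    have h2p := h2 p.2
    have h3p := h3 p.1
    simp only [Complex.ofReal_re] at h2p h3p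
    rw [norm_mul (_ / _) (_ / _), ← hg]
    have f1 : ((p.1.factorial : ℕ) : ℝ) ≠ 0 := by exact_mod_cast Nat.factorial_ne_zero _
    have f2 : ((p.2.factorial : ℕ) : ℝ) ≠ 0 := by exact_mod_cast Nat.factorial_ne_zero _
    calc _ = ‖poch a (p.1 + p.2) / poch (a.re : ℂ) (p.1 + p.2)‖ *
          (‖B p‖ * ((p.1.factorial : ℝ) * (p.2.factorial : ℝ))) *
          ‖poch (μ.re : ℂ) p.2 / (p.2.factorial : ℂ)‖ *
          ‖poch ((a - μ).re : ℂ) p.1 / (p.1.factorial : ℂ)‖ * (g * |v| ^ p.1) := by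
          simp only [norm_mul, norm_div, norm_pow, Complex.norm_natCast, Complex.norm_real,
            Real.norm_eq_abs]
          field_simp
      _ ≤ K1 * (K * (((p.1 : ℝ) + 1) ^ q * ((p.2 : ℝ) + 1) ^ (-μ.re - δ))) *
          (K2 * ((p.2 : ℝ) + 1) ^ (μ.re - 1)) * (K3 * ((p.1 : ℝ) + 1) ^ ((a - μ).re - 1)) *
          (g * |v| ^ p.1) := by
          refine mul_le_mul_of_nonneg_right ?_ (by positivity)
          refine mul_le_mul ?_ h3p (norm_nonneg _) (by positivity)
          refine mul_le_mul ?_ h2p (norm_nonneg _) (by positivity)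
          exact mul_le_mul h1p (hB p) (by positivity) (by positivity)
      _ = _ := by
        rw [show -1 - δ = (-μ.re - δ) + (μ.re - 1) by ring, Real.rpow_add hm1, Real.rpow_add hm2]
        ring
  have hS := hasSum_integral_of_summable_integral_norm hintg hsum
  rw [← hS.tsum_eq, hS.summable.tsum_prod, ← tsum_mul_left]
  refine tsum_congr fun j => ?_
  rw [tsum_congr (fun m => hval (j, m))]
  rw [tsum_mul_left]
  congr 1
  exact tsum_mul_left (f := fun m : ℕ => poch μ m * B (j, m)) (a := poch (a - μ) j * (v : ℂ) ^ j)

/-! ### Change of variables -/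

theorem cov (x : ℝ) {s : ℝ} (hs : 0 < s) (g : ℝ → ℂ) :
    ∫ y in Iio x, g y = ∫ u in Ioo (0 : ℝ) 1, (s / (1 - u) ^ 2) • g (x - s * (u / (1 - u))) := by
  have himg : (fun u : ℝ => x - s * (u / (1 - u))) '' Ioo 0 1 = Iio x := by
    ext y
    constructor
    · rintro ⟨u, hu, rfl⟩
      have h1 : 0 < 1 - u := by linarith [hu.2]
      have : 0 < s * (u / (1 - u)) := mul_pos hs (div_pos hu.1 h1)
      simp only [mem_Iio]
      linarith
    · intro hy
      have hy : y < x := hy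
      have hd : 0 < s + (x - y) := by linarith
      refine ⟨(x - y) / (s + (x - y)), ⟨div_pos (by linarith) hd, (div_lt_one hd).2 (by linarith)⟩, ?_⟩
      have e : 1 - (x - y) / (s + (x - y)) = s / (s + (x - y)) := by
        field_simp
        ring
      simp only
      rw [e]
      field_simp
      ring
  have hder : ∀ u ∈ Ioo (0 : ℝ) 1, HasDerivWithinAt (fun u : ℝ => x - s * (u / (1 - u)))
      (-(s / (1 - u) ^ 2)) (Ioo 0 1) u := by
    intro u hu
    have h1 : 1 - u ≠ 0 := by linarith [hu.2]
    have h2 := ((hasDerivAt_id u).div ((hasDerivAt_id u).const_sub 1) h1)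
    have h3 := (h2.const_mul s).const_sub x
    refine (h3.congr_deriv ?_).hasDerivWithinAt
    simp only [id]
    field_simp
    ring
  have hinj : InjOn (fun u : ℝ => x - s * (u / (1 - u))) (Ioo 0 1) := by
    intro u hu w hw h
    have h1 : 1 - u ≠ 0 := by linarith [hu.2]
    have h2 : 1 - w ≠ 0 := by linarith [hw.2]
    simp only at h
    have h3 : u / (1 - u) = w / (1 - w) := mul_left_cancel₀ hs.ne' (by linarith)
    rw [div_eq_div_iff h1 h2] at h3
    linarith
  rw [← himg, integral_image_eq_integral_abs_deriv_smul measurableSet_Ioo hder hinj]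
  refine setIntegral_congr_fun measurableSet_Ioo fun u hu => ?_
  have h1 : 0 < 1 - u := by linarith [hu.2]
  rw [abs_neg, abs_of_nonneg (by positivity)]

theorem jac_factor {a μ : ℂ} {s u : ℝ} (hs : 0 < s) (hu : u ∈ Ioo (0 : ℝ) 1) :
    ((s / (1 - u) ^ 2 : ℝ) : ℂ) * (((1 - u : ℝ) : ℂ) ^ a * ((s * (u / (1 - u)) : ℝ) : ℂ) ^ (μ - 1))
      = (s : ℂ) ^ μ * bint μ (a - μ) u := by
  have h1 : 0 < 1 - u := by linarith [hu.2]
  have hsc : (s : ℂ) ≠ 0 := by exact_mod_cast hs.ne'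
  have hwc : ((1 - u : ℝ) : ℂ) ≠ 0 := by exact_mod_cast h1.ne'
  have e : (1 : ℂ) - u = ((1 - u : ℝ) : ℂ) := by push_cast; rfl
  rw [bint, e]
  set w := 1 - u with hw
  have e1 : ((s * (u / w) : ℝ) : ℂ) ^ (μ - 1) =
      (s : ℂ) ^ (μ - 1) * ((u : ℂ) ^ (μ - 1) * ((w : ℂ) ^ (μ - 1))⁻¹) := by
    rw [Complex.ofReal_mul, Complex.mul_cpow_ofReal_nonneg hs.le (div_nonneg hu.1.le h1.le),
      div_eq_mul_inv, Complex.ofReal_mul,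
      Complex.mul_cpow_ofReal_nonneg hu.1.le (inv_nonneg.2 h1.le), Complex.ofReal_inv,
      Complex.inv_cpow]
    rw [Complex.arg_ofReal_of_nonneg h1.le]
    exact Real.pi_pos.ne
  have e2 : (w : ℂ) ^ a = (w : ℂ) ^ (a - μ - 1) * (w : ℂ) ^ (μ - 1) * (w : ℂ) ^ 2 := by
    rw [← Complex.cpow_add _ _ hwc, ← Complex.cpow_natCast, ← Complex.cpow_add _ _ hwc]
    congr 1
    push_cast
    ring
  have e3 : (s : ℂ) ^ μ = (s : ℂ) ^ (μ - 1) * s := by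
    rw [Complex.cpow_sub _ _ hsc, Complex.cpow_one]
    field_simp
  have hwp : (w : ℂ) ^ (μ - 1) ≠ 0 := by
    rw [Ne, Complex.cpow_eq_zero_iff]
    exact fun h => hwc h.1
  rw [e1, e2, e3]
  push_cast
  field_simp

theorem bint_shift {s t : ℂ} {u : ℝ} (hu : u ∈ Ioo (0 : ℝ) 1) (j m : ℕ) :
    bint (s + m) (t + j) u = bint s t u * (((1 - u : ℝ) : ℂ) ^ j * (u : ℂ) ^ m) := by
  have h1 : 0 < 1 - u := by linarith [hu.2]
  have hwc : ((1 - u : ℝ) : ℂ) ≠ 0 := by exact_mod_cast h1.ne'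
  have huc : (u : ℂ) ≠ 0 := by exact_mod_cast hu.1.ne'
  have e : (1 : ℂ) - u = ((1 - u : ℝ) : ℂ) := by push_cast; rfl
  rw [bint, bint, e, show s + m - 1 = s - 1 + m by ring, show t + j - 1 = t - 1 + j by ring,
    Complex.cpow_add _ _ huc, Complex.cpow_add _ _ hwc, Complex.cpow_natCast, Complex.cpow_natCast]
  ring

theorem master {a b c μ : ℂ} (ha : μ.re < a.re) (hμ : 0 < μ.re) {v x s : ℝ} (hs : 0 < s)
    (hv : |v| < 1) (B : ℕ × ℕ → ℂ) (κ : ℂ)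
    {K q δ : ℝ} (hδ : 0 < δ) (hB : ∀ p : ℕ × ℕ, ‖B p‖ * ((p.1.factorial : ℝ) * (p.2.factorial : ℝ)) ≤
      K * (((p.1 : ℝ) + 1) ^ q * ((p.2 : ℝ) + 1) ^ (-μ.re - δ)))
    (hG : ∀ u ∈ Ioo (0 : ℝ) 1, hypF a b c (x - s * (u / (1 - u))) = κ * ((1 - u : ℝ) : ℂ) ^ a *
      ∑' p : ℕ × ℕ, poch a (p.1 + p.2) * B p * ((v * (1 - u) : ℝ) : ℂ) ^ p.1 * (u : ℂ) ^ p.2) :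
    ∫ y in Iio x, hypF a b c y * (((x - y : ℝ) : ℂ) ^ (μ - 1) / Complex.Gamma μ) =
      κ * (s : ℂ) ^ μ * (Complex.Gamma (a - μ) / Complex.Gamma a) *
        ∑' j : ℕ, poch (a - μ) j * (v : ℂ) ^ j * ∑' m : ℕ, poch μ m * B (j, m) := by
  have hΓ : Complex.Gamma μ ≠ 0 := Complex.Gamma_ne_zero (ne_neg_of_re_pos hμ)
  rw [cov x hs]
  have h : ∀ u ∈ Ioo (0 : ℝ) 1, (s / (1 - u) ^ 2) • (hypF a b c (x - s * (u / (1 - u))) *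
      (((x - (x - s * (u / (1 - u))) : ℝ) : ℂ) ^ (μ - 1) / Complex.Gamma μ)) =
      κ * (s : ℂ) ^ μ / Complex.Gamma μ * ∑' p : ℕ × ℕ, poch a (p.1 + p.2) * B p * (v : ℂ) ^ p.1 *
        bint (μ + p.2) (a - μ + p.1) u := by
    intro u hu
    rw [hG u hu, sub_sub_cancel, Complex.real_smul]
    have e : ∀ p : ℕ × ℕ, poch a (p.1 + p.2) * B p * (v : ℂ) ^ p.1 *
        bint (μ + p.2) (a - μ + p.1) u = bint μ (a - μ) u *
        (poch a (p.1 + p.2) * B p * ((v * (1 - u) : ℝ) : ℂ) ^ p.1 * (u : ℂ) ^ p.2) := by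
      intro p
      rw [bint_shift hu, Complex.ofReal_mul, mul_pow]
      ring
    rw [tsum_congr e, tsum_mul_left]
    have := jac_factor (a := a) (μ := μ) hs hu
    set S := ∑' p : ℕ × ℕ, poch a (p.1 + p.2) * B p * ((v * (1 - u) : ℝ) : ℂ) ^ p.1 * (u : ℂ) ^ p.2
    linear_combination (κ / Complex.Gamma μ * S) * this
  rw [setIntegral_congr_fun measurableSet_Ioo h, integral_const_mul, core ha hμ hv B hδ hB]
  field_simp

/-! ### The two cases -/

theorem case_nonneg (a b c μ : ℂ) (ha : μ.re < a.re) (hb : μ.re < b.re) (hμ : 0 < μ.re)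
    (hc1 : ∀ n : ℕ, c ≠ -(n : ℂ)) (hc2 : ∀ n : ℕ, c - μ ≠ -(n : ℂ))
    (x : ℝ) (hx0 : 0 ≤ x) (hx : x < 1) :
    ∫ y in Iio x,
        hypF a b c y * (((x - y : ℝ) : ℂ) ^ (μ - 1) / Complex.Gamma μ)
      = Complex.Gamma (a - μ) / Complex.Gamma a * (Complex.Gamma (b - μ) / Complex.Gamma b) *
        (Complex.Gamma c / Complex.Gamma (c - μ)) * hypF (a - μ) (b - μ) (c - μ) x := by
  have hbpos : 0 < b.re := by linarith
  have hbn := ne_neg_of_re_pos hbpos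
  have hbμ : 0 < (b - μ).re := by simp; linarith
  have hbμn := ne_neg_of_re_pos hbμ
  obtain ⟨K1, hK1, h1⟩ := poch_upper b
  obtain ⟨K2, hK2, h2⟩ := poch_upper (c - b)
  obtain ⟨K3, hK3, h3⟩ := poch_lower hc1
  let B : ℕ × ℕ → ℂ := fun p => poch b p.1 * poch (c - b) p.2 /
        (poch c (p.1 + p.2) * (p.1.factorial : ℂ) * (p.2.factorial : ℂ))
  have hB : ∀ p : ℕ × ℕ, ‖B p‖ * ((p.1.factorial : ℝ) * (p.2.factorial : ℝ)) ≤
      (K1 * K2 * K3) * (((p.1 : ℝ) + 1) ^ (b.re - 1 + |1 - c.re|) *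
        ((p.2 : ℝ) + 1) ^ (-μ.re - (b.re - μ.re))) := by
    intro p
    have f1 : (0 : ℝ) < (p.1.factorial : ℝ) := by exact_mod_cast Nat.factorial_pos _
    have f2 : (0 : ℝ) < (p.2.factorial : ℝ) := by exact_mod_cast Nat.factorial_pos _
    have hp1 : (0 : ℝ) < (p.1 : ℝ) + 1 := by positivity
    have hp2 : (0 : ℝ) < (p.2 : ℝ) + 1 := by positivity
    have hp3 : (0 : ℝ) < ((p.1 + p.2 : ℕ) : ℝ) + 1 := by positivity
    have hP : 0 < ‖poch c (p.1 + p.2)‖ := norm_pos_iff.2 (poch_ne_zero hc1 _)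
    have hf : (p.1.factorial : ℝ) * (p.2.factorial : ℝ) ≤ ((p.1 + p.2).factorial : ℝ) := by
      exact_mod_cast Nat.le_of_dvd (Nat.factorial_pos _) (Nat.factorial_mul_factorial_dvd_factorial_add _ _)
    have e : ‖B p‖ * ((p.1.factorial : ℝ) * (p.2.factorial : ℝ)) =
        ‖poch b p.1‖ * ‖poch (c - b) p.2‖ / ‖poch c (p.1 + p.2)‖ := by
      simp only [B, norm_mul, norm_div, Complex.norm_natCast]
      field_simp
    rw [e, div_le_iff₀ hP]
    have h4 := rpow_split_le (1 - c.re) p.1 p.2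
    have h5 := h3 (p.1 + p.2)
    have h6 : (p.1.factorial : ℝ) * (p.2.factorial : ℝ) ≤
        K3 * ‖poch c (p.1 + p.2)‖ * (((p.2 : ℝ) + 1) ^ (1 - c.re) * ((p.1 : ℝ) + 1) ^ |1 - c.re|) := by
      calc _ ≤ ((p.1 + p.2).factorial : ℝ) := hf
        _ = ((p.1 + p.2).factorial : ℝ) * (((p.1 + p.2 : ℕ) : ℝ) + 1) ^ (c.re - 1) *
            (((p.1 + p.2 : ℕ) : ℝ) + 1) ^ (1 - c.re) := by
            rw [mul_assoc, ← Real.rpow_add hp3]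
            simp
        _ ≤ _ := mul_le_mul h5 h4 (by positivity) (by positivity)
    calc ‖poch b p.1‖ * ‖poch (c - b) p.2‖ ≤
        (K1 * (p.1.factorial * ((p.1 : ℝ) + 1) ^ (b.re - 1))) *
        (K2 * (p.2.factorial * ((p.2 : ℝ) + 1) ^ ((c - b).re - 1))) :=
          mul_le_mul (h1 _) (h2 _) (norm_nonneg _) (by positivity)
      _ = K1 * K2 * (((p.1 : ℝ) + 1) ^ (b.re - 1) * ((p.2 : ℝ) + 1) ^ ((c - b).re - 1)) *
          ((p.1.factorial : ℝ) * (p.2.factorial : ℝ)) := by ring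
      _ ≤ K1 * K2 * (((p.1 : ℝ) + 1) ^ (b.re - 1) * ((p.2 : ℝ) + 1) ^ ((c - b).re - 1)) *
          (K3 * ‖poch c (p.1 + p.2)‖ *
            (((p.2 : ℝ) + 1) ^ (1 - c.re) * ((p.1 : ℝ) + 1) ^ |1 - c.re|)) :=
          mul_le_mul_of_nonneg_left h6 (by positivity)
      _ = _ := by
          rw [show -μ.re - (b.re - μ.re) = ((c - b).re - 1) + (1 - c.re) by simp; ring,
            Real.rpow_add hp1, Real.rpow_add hp2]
          ring
  have hG : ∀ u ∈ Ioo (0 : ℝ) 1, hypF a b c (x - 1 * (u / (1 - u))) = 1 * ((1 - u : ℝ) : ℂ) ^ a *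
      ∑' p : ℕ × ℕ, poch a (p.1 + p.2) * B p * ((x * (1 - u) : ℝ) : ℂ) ^ p.1 * (u : ℂ) ^ p.2 := by
    intro u hu
    have hw : 0 < 1 - u := by linarith [hu.2]
    have hwc : ((1 - u : ℝ) : ℂ) ≠ 0 := by exact_mod_cast hw.ne'
    have hX1 : x * (1 - u) < 1 := by nlinarith [hu.1]
    have hX0 : 0 ≤ x * (1 - u) := by positivity
    have hX2 : 0 < 1 - x * (1 - u) := by linarith
    have ey : x - 1 * (u / (1 - u)) = (x * (1 - u) - u) / (1 - u) := by
      field_simp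
    rw [ey]
    by_cases hy : u ≤ x * (1 - u)
    · have h := appell_reduction a (b := b) (b' := c - b) (c := c) (by ring) hc1 hu.1.le hy hX1
      rw [h, hypF, if_pos (div_nonneg (by linarith) hw.le), one_mul, ← mul_assoc,
        ← Complex.cpow_add _ _ hwc]
      simp [gterm]
    · have hy : x * (1 - u) < u := not_le.1 hy
      have h := appell_reduction a (b := c - b) (b' := b) (c := c) (by ring) hc1 hX0 hy.le hu.2
      have hsw : ∑' p : ℕ × ℕ, poch a (p.1 + p.2) * B p * ((x * (1 - u) : ℝ) : ℂ) ^ p.1 * (u : ℂ) ^ p.2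
          = ∑' p : ℕ × ℕ, poch a (p.1 + p.2) * (poch (c - b) p.1 * poch b p.2 /
        (poch c (p.1 + p.2) * (p.1.factorial : ℂ) * (p.2.factorial : ℂ))) *
        (u : ℂ) ^ p.1 * ((x * (1 - u) : ℝ) : ℂ) ^ p.2 := by
        rw [← (Equiv.prodComm ℕ ℕ).tsum_eq]
        refine tsum_congr fun p => ?_
        simp only [B, Equiv.prodComm_apply, Prod.fst_swap, Prod.snd_swap]
        rw [add_comm p.2 p.1]
        ring
      have hneg : ¬ 0 ≤ (x * (1 - u) - u) / (1 - u) :=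
        not_le.2 (div_neg_of_neg_of_pos (by linarith) hw)
      rw [hsw, h, hypF, if_neg hneg]
      have e1 : 1 - (x * (1 - u) - u) / (1 - u) = (1 - x * (1 - u)) * (1 - u)⁻¹ := by
        field_simp
        ring
      have e2 : (x * (1 - u) - u) / (1 - u) / ((x * (1 - u) - u) / (1 - u) - 1) =
          (u - x * (1 - u)) / (1 - x * (1 - u)) := by
        have : (x * (1 - u) - u) / (1 - u) - 1 = -((1 - x * (1 - u)) / (1 - u)) := by
          field_simp
          ring
        rw [this]
        field_simp
        ring
      rw [e2, e1, Complex.ofReal_mul, Complex.mul_cpow_ofReal_nonneg hX2.le (inv_nonneg.2 hw.le),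
        Complex.ofReal_inv, Complex.inv_cpow, Complex.cpow_neg ((1 - u : ℝ) : ℂ), inv_inv]
      · simp only [gterm]
        ring
      · rw [Complex.arg_ofReal_of_nonneg hw.le]
        exact Real.pi_pos.ne
  rw [master ha hμ one_pos (by rwa [abs_of_nonneg hx0]) B 1 (by linarith) hB hG, hypF, if_pos hx0]
  have hin : ∀ j : ℕ, ∑' m : ℕ, poch μ m * B (j, m) =
      (Complex.Gamma (b - μ) / Complex.Gamma b) * (Complex.Gamma c / Complex.Gamma (c - μ)) *
      (poch (b - μ) j / (poch (c - μ) j * (j.factorial : ℂ))) := by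
    intro j
    have hj : (0 : ℝ) ≤ j := Nat.cast_nonneg j
    have g := gauss (A := μ) (B := c - b) (C := c + j) (ne_neg_add hc1 j) (by simp; linarith)
      (by rw [show c + j - μ = c - μ + j by ring]; exact ne_neg_add hc2 j)
      (by rw [show c + j - (c - b) = b + j by ring]; exact ne_neg_add hbn j)
    rw [show c + j - μ - (c - b) = b - μ + j by ring, show c + j - μ = c - μ + j by ring,
      show c + j - (c - b) = b + j by ring, Gamma_add_nat hc1, Gamma_add_nat hc2, Gamma_add_nat hbn,
      Gamma_add_nat hbμn] at g
    have e : ∀ m : ℕ, poch μ m * B (j, m) = poch b j / (poch c j * (j.factorial : ℂ)) *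
        gterm μ (c - b) (c + j) m := by
      intro m
      have := poch_ne_zero (ne_neg_add hc1 j) m
      have := poch_ne_zero hc1 j
      simp only [B, gterm, poch_add]
      field_simp
    rw [tsum_congr e, tsum_mul_left, g]
    have := poch_ne_zero hc1 j
    have := poch_ne_zero hbn j
    field_simp
  simp_rw [hin]
  simp only [Complex.ofReal_one, Complex.one_cpow, one_mul, mul_one]
  rw [mul_assoc, mul_assoc, ← tsum_mul_left, ← tsum_mul_left, ← tsum_mul_left, ← tsum_mul_left]
  refine tsum_congr fun j => ?_
  ring

theorem case_neg (a b c μ : ℂ) (ha : μ.re < a.re) (hb : μ.re < b.re) (hμ : 0 < μ.re)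
    (hc1 : ∀ n : ℕ, c ≠ -(n : ℂ)) (hc2 : ∀ n : ℕ, c - μ ≠ -(n : ℂ))
    (x : ℝ) (hx : x < 0) :
    ∫ y in Iio x,
        hypF a b c y * (((x - y : ℝ) : ℂ) ^ (μ - 1) / Complex.Gamma μ)
      = Complex.Gamma (a - μ) / Complex.Gamma a * (Complex.Gamma (b - μ) / Complex.Gamma b) *
        (Complex.Gamma c / Complex.Gamma (c - μ)) * hypF (a - μ) (b - μ) (c - μ) x := by
  have hbpos : 0 < b.re := by linarith
  have hbn := ne_neg_of_re_pos hbpos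
  have hbμ : 0 < (b - μ).re := by simp; linarith
  have hs : 0 < 1 - x := by linarith
  have hsc : ((1 - x : ℝ) : ℂ) ≠ 0 := by exact_mod_cast hs.ne'
  set v : ℝ := x / (x - 1) with hvdef
  have hv0 : 0 < v := div_pos_of_neg_of_neg hx (by linarith)
  have hv1 : v < 1 := by
    rw [hvdef, div_lt_one_of_neg (by linarith)]
    linarith
  obtain ⟨K1, hK1, h1⟩ := poch_div_upper (c - b) hc1
  let B : ℕ × ℕ → ℂ := fun p => poch (c - b) (p.1 + p.2) /
        (poch c (p.1 + p.2) * (p.1.factorial : ℂ) * (p.2.factorial : ℂ))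
  have hB : ∀ p : ℕ × ℕ, ‖B p‖ * ((p.1.factorial : ℝ) * (p.2.factorial : ℝ)) ≤
      K1 * (((p.1 : ℝ) + 1) ^ |-b.re| * ((p.2 : ℝ) + 1) ^ (-μ.re - (b.re - μ.re))) := by
    intro p
    have f1 : (0 : ℝ) < (p.1.factorial : ℝ) := by exact_mod_cast Nat.factorial_pos _
    have f2 : (0 : ℝ) < (p.2.factorial : ℝ) := by exact_mod_cast Nat.factorial_pos _
    have hP : 0 < ‖poch c (p.1 + p.2)‖ := norm_pos_iff.2 (poch_ne_zero hc1 _)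
    have e : ‖B p‖ * ((p.1.factorial : ℝ) * (p.2.factorial : ℝ)) =
        ‖poch (c - b) (p.1 + p.2) / poch c (p.1 + p.2)‖ := by
      simp only [B, norm_mul, norm_div, Complex.norm_natCast]
      field_simp
    rw [e]
    refine (h1 _).trans ?_
    refine mul_le_mul_of_nonneg_left ?_ hK1.le
    rw [show (c - b).re - c.re = -b.re by simp, show -μ.re - (b.re - μ.re) = -b.re by ring]
    exact (rpow_split_le (-b.re) p.1 p.2).trans_eq (mul_comm _ _)
  have hG : ∀ u ∈ Ioo (0 : ℝ) 1, hypF a b c (x - (1 - x) * (u / (1 - u))) =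
      ((1 - x : ℝ) : ℂ) ^ (-a) * ((1 - u : ℝ) : ℂ) ^ a *
      ∑' p : ℕ × ℕ, poch a (p.1 + p.2) * B p * ((v * (1 - u) : ℝ) : ℂ) ^ p.1 * (u : ℂ) ^ p.2 := by
    intro u hu
    have hw : 0 < 1 - u := by linarith [hu.2]
    have hwc : ((1 - u : ℝ) : ℂ) ≠ 0 := by exact_mod_cast hw.ne'
    have hp0 : 0 ≤ v * (1 - u) := by positivity
    have hr1 : v * (1 - u) + u < 1 := by nlinarith
    have hr0 : 0 ≤ v * (1 - u) + u := by linarith [hu.1]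
    have hne : x - 1 ≠ 0 := by linarith
    have e1 : 1 - (x - (1 - x) * (u / (1 - u))) = (1 - x) * (1 - u)⁻¹ := by
      field_simp
      ring
    have e2 : (x - (1 - x) * (u / (1 - u))) / (x - (1 - x) * (u / (1 - u)) - 1) =
        v * (1 - u) + u := by
      have : x - (1 - x) * (u / (1 - u)) - 1 = (x - 1) / (1 - u) := by
        field_simp
        ring
      rw [this, hvdef]
      field_simp
      ring
    have hneg : ¬ 0 ≤ x - (1 - x) * (u / (1 - u)) := by
      have : 0 < (1 - x) * (u / (1 - u)) := mul_pos hs (div_pos hu.1 hw)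
      linarith
    have hsm := gterm_geom_summable a (c - b) hc1 hr0 hr1
    have hbe := binom_expand (fun k => poch a k * poch (c - b) k / poch c k) hp0 hu.1.le (by
      refine hsm.congr fun k => ?_
      simp only [gterm, norm_mul, norm_div, Complex.norm_natCast]
      rw [div_div])
    rw [hypF, if_neg hneg, e2, e1, Complex.ofReal_mul,
      Complex.mul_cpow_ofReal_nonneg hs.le (inv_nonneg.2 hw.le),
        Complex.ofReal_inv, Complex.inv_cpow, Complex.cpow_neg ((1 - u : ℝ) : ℂ), inv_inv]
    · congr 1
      simp only [div_div] at hbe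
      rw [hbe]
      refine tsum_congr fun p => ?_
      simp only [B]
      ring
    · rw [Complex.arg_ofReal_of_nonneg hw.le]
      exact Real.pi_pos.ne
  rw [master ha hμ hs (by rwa [abs_of_pos hv0]) B _ (by linarith) hB hG, hypF, if_neg (not_le.2 hx)]
  have hin : ∀ j : ℕ, ∑' m : ℕ, poch μ m * B (j, m) =
      (Complex.Gamma (b - μ) / Complex.Gamma b) * (Complex.Gamma c / Complex.Gamma (c - μ)) *
      (poch (c - b) j / (poch (c - μ) j * (j.factorial : ℂ))) := by
    intro j
    have g := gauss (A := μ) (B := c - b + j) (C := c + j) (ne_neg_add hc1 j) (by simp; linarith)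
      (by rw [show c + j - μ = c - μ + j by ring]; exact ne_neg_add hc2 j)
      (by rw [show c + j - (c - b + j) = b by ring]; exact hbn)
    rw [show c + j - μ - (c - b + j) = b - μ by ring, show c + j - μ = c - μ + j by ring,
      show c + j - (c - b + j) = b by ring, Gamma_add_nat hc1, Gamma_add_nat hc2] at g
    have e : ∀ m : ℕ, poch μ m * B (j, m) = poch (c - b) j / (poch c j * (j.factorial : ℂ)) *
        gterm μ (c - b + j) (c + j) m := by
      intro m
      have := poch_ne_zero (ne_neg_add hc1 j) m
      have := poch_ne_zero hc1 j
      simp only [B, gterm, poch_add]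
      field_simp
    rw [tsum_congr e, tsum_mul_left, g]
    have := poch_ne_zero hc1 j
    field_simp
  simp_rw [hin]
  rw [show c - μ - (b - μ) = c - b by ring, show -(a - μ) = -a + μ by ring,
    Complex.cpow_add _ _ hsc, ← tsum_mul_left, ← tsum_mul_left, ← tsum_mul_left]
  refine tsum_congr fun j => ?_
  ring

/-- Fractional integral transformation of type `a-, b-, c-` (generalizing Camporesi). -/
theorem stmt_5 (a b c μ : ℂ) (ha : μ.re < a.re) (hb : μ.re < b.re) (hμ : 0 < μ.re)
    (hc1 : ∀ n : ℕ, c ≠ -(n : ℂ)) (hc2 : ∀ n : ℕ, c - μ ≠ -(n : ℂ))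
    (x : ℝ) (hx : x < 1) :
    ∫ y in Iio x,
        hypF a b c y * (((x - y : ℝ) : ℂ) ^ (μ - 1) / Complex.Gamma μ)
      = Complex.Gamma (a - μ) / Complex.Gamma a * (Complex.Gamma (b - μ) / Complex.Gamma b) *
        (Complex.Gamma c / Complex.Gamma (c - μ)) * hypF (a - μ) (b - μ) (c - μ) x := by
  rcases le_or_gt 0 x with h | h
  · exact case_nonneg a b c μ ha hb hμ hc1 hc2 x h hx
  · exact case_neg a b c μ ha hb hμ hc1 hc2 x h
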